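/- arXiv:1712.01378 — 8 statements merged into one kernel-verified Lean document; each statement's English description precedes it below -/
import Mathlib

section
/- Let Ψ_X ∈ ℂ^{N×M} have economy SVD Ψ_X = U Σ Vᴴ, where U ∈ ℂ^{N×r} and V ∈ ℂ^{M×r} have orthonormal columns (UᴴU = VᴴV = I_r) and Σ ∈ ℝ^{r×r} is diagonal with strictly positive diagonal entries. Then for every Ψ_Y ∈ ℂ^{N×M}, every A ∈ ℂ^{N×N'}, and every K̂ ∈ ℂ^{r×r}: ‖(Ψ_Yᴴ − Ψ_Xᴴ U K̂ Uᴴ) A‖_F² = ‖(Vᴴ Ψ_Yᴴ − Σ K̂ Uᴴ) A‖_F² + ‖(I_M − V Vᴴ) Ψ_Yᴴ A‖_F². In particular, K̂ minimizes the restricted EDMD error J(K̂) = ‖(Ψ_Yᴴ − Ψ_Xᴴ U K̂ Uᴴ) A‖_F² if and only if it minimizes J'(K̂) = ‖(Vᴴ Ψ_Yᴴ − Σ K̂ Uᴴ) A‖_F². -/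
open Matrix

/-- Squared Frobenius norm of a complex matrix. -/
noncomputable def frobSq {m n : Type*} [Fintype m] [Fintype n] (A : Matrix m n ℂ) : ℝ :=
  ∑ i, ∑ j, ‖A i j‖ ^ 2

theorem frobSq_eq_trace {m n : Type*} [Fintype m] [Fintype n] (A : Matrix m n ℂ) :
    (frobSq A : ℂ) = (Aᴴ * A).trace := by
  simp only [frobSq, trace, diag_apply, mul_apply, conjTranspose_apply]
  rw [Finset.sum_comm]
  push_cast
  refine Finset.sum_congr rfl fun j _ => Finset.sum_congr rfl fun i _ => ?_
  exact (Complex.conj_mul' (A i j)).symm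

/-- Pythagorean identity for the orthogonal projection onto the column span of an isometry. -/
theorem frobSq_eq_add_of_conjTranspose_mul_self {m k n : Type*} [Fintype m] [Fintype k]
    [Fintype n] [DecidableEq m] [DecidableEq k] {V : Matrix m k ℂ} (hV : Vᴴ * V = 1)
    (W : Matrix m n ℂ) :
    frobSq W = frobSq (Vᴴ * W) + frobSq ((1 - V * Vᴴ) * W) := by
  have hV' (X : Matrix k n ℂ) : Vᴴ * (V * X) = X := by
    rw [← Matrix.mul_assoc, hV, Matrix.one_mul]
  apply Complex.ofReal_injective
  push_cast
  simp only [frobSq_eq_trace]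
  rw [← trace_add]
  congr 1
  simp only [conjTranspose_mul, conjTranspose_sub,
    conjTranspose_conjTranspose, Matrix.mul_assoc, Matrix.sub_mul, Matrix.mul_sub,
    Matrix.one_mul, hV']
  abel

/-- With an economy SVD `Ψ_X = U Σ Vᴴ`, the EDMD error for `K = U K̂ Uᴴ` splits as
`‖(Ψ_Yᴴ − Ψ_Xᴴ U K̂ Uᴴ) A‖_F² = ‖(Vᴴ Ψ_Yᴴ − Σ K̂ Uᴴ) A‖_F² + ‖(I − V Vᴴ) Ψ_Yᴴ A‖_F²`;
in particular `K̂` minimizes the restricted error iff it minimizes the reduced error. -/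
theorem edmd_error_splitting
    {N M r N' : ℕ}
    (ΨX : Matrix (Fin N) (Fin M) ℂ)
    (U : Matrix (Fin N) (Fin r) ℂ) (V : Matrix (Fin M) (Fin r) ℂ)
    (σ : Fin r → ℝ) (hσ : ∀ i, 0 < σ i)
    (hU : Uᴴ * U = 1) (hV : Vᴴ * V = 1)
    (hSVD : ΨX = U * Matrix.diagonal (fun i => (σ i : ℂ)) * Vᴴ) :
    (∀ (ΨY : Matrix (Fin N) (Fin M) ℂ) (A : Matrix (Fin N) (Fin N') ℂ)
        (Khat : Matrix (Fin r) (Fin r) ℂ),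
        frobSq ((ΨYᴴ - ΨXᴴ * U * Khat * Uᴴ) * A)
          = frobSq ((Vᴴ * ΨYᴴ - Matrix.diagonal (fun i => (σ i : ℂ)) * Khat * Uᴴ) * A)
            + frobSq (((1 : Matrix (Fin M) (Fin M) ℂ) - V * Vᴴ) * ΨYᴴ * A))
    ∧ (∀ (ΨY : Matrix (Fin N) (Fin M) ℂ) (A : Matrix (Fin N) (Fin N') ℂ)
        (Khat : Matrix (Fin r) (Fin r) ℂ),
        (∀ K' : Matrix (Fin r) (Fin r) ℂ,
            frobSq ((ΨYᴴ - ΨXᴴ * U * Khat * Uᴴ) * A)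
              ≤ frobSq ((ΨYᴴ - ΨXᴴ * U * K' * Uᴴ) * A))
          ↔ (∀ K' : Matrix (Fin r) (Fin r) ℂ,
            frobSq ((Vᴴ * ΨYᴴ - Matrix.diagonal (fun i => (σ i : ℂ)) * Khat * Uᴴ) * A)
              ≤ frobSq ((Vᴴ * ΨYᴴ - Matrix.diagonal (fun i => (σ i : ℂ)) * K' * Uᴴ) * A))) := by
  have hX : ΨXᴴ * U = V * diagonal (fun i => (σ i : ℂ)) := by
    have hd : (diagonal (fun i => (σ i : ℂ)))ᴴ = diagonal (fun i => (σ i : ℂ)) := by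
      rw [diagonal_conjTranspose]
      congr 1
      ext i
      simp
    rw [hSVD, conjTranspose_mul, conjTranspose_mul, hd, conjTranspose_conjTranspose]
    simp only [Matrix.mul_assoc, hU, Matrix.mul_one]
  have hsplit (ΨY : Matrix (Fin N) (Fin M) ℂ) (A : Matrix (Fin N) (Fin N') ℂ)
      (Khat : Matrix (Fin r) (Fin r) ℂ) :
      frobSq ((ΨYᴴ - ΨXᴴ * U * Khat * Uᴴ) * A)
        = frobSq ((Vᴴ * ΨYᴴ - diagonal (fun i => (σ i : ℂ)) * Khat * Uᴴ) * A)
          + frobSq (((1 : Matrix (Fin M) (Fin M) ℂ) - V * Vᴴ) * ΨYᴴ * A) := by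
    have hV' (X : Matrix (Fin r) (Fin N') ℂ) : Vᴴ * (V * X) = X := by
      rw [← Matrix.mul_assoc, hV, Matrix.one_mul]
    rw [frobSq_eq_add_of_conjTranspose_mul_self hV, hX]
    congr 2 <;>
      simp only [Matrix.mul_assoc, Matrix.sub_mul, Matrix.mul_sub, Matrix.one_mul, hV',
        sub_self, sub_zero]
  refine ⟨hsplit, fun ΨY A Khat => ?_⟩
  simp only [hsplit, add_le_add_iff_right]
end

section
/- Let Ψ_X ∈ ℂ^{N×M} have economy SVD Ψ_X = U Σ Vᴴ (U ∈ ℂ^{N×r}, V ∈ ℂ^{M×r} with orthonormal columns, Σ ∈ ℝ^{r×r} diagonal with strictly positive entries), let Ψ_Y ∈ ℂ^{N×M}, and suppose A = U B for some B ∈ ℂ^{r×N'} of rank r (so that the range of A equals the range of U). Then the KDMD matrix K̂ = Σ⁻¹ Vᴴ Ψ_Yᴴ U is the unique minimizer over ℂ^{r×r} of J'(K̂) = ‖(Vᴴ Ψ_Yᴴ − Σ K̂ Uᴴ) A‖_F², and it equals Σ⁻¹ Vᴴ Ψ_Yᴴ Ψ_X V Σ⁻¹. -/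
open Matrix

theorem frobSq_nonneg {m n : Type*} [Fintype m] [Fintype n] (A : Matrix m n ℂ) :
    0 ≤ frobSq A :=
  Finset.sum_nonneg fun _ _ => Finset.sum_nonneg fun _ _ => sq_nonneg _

theorem frobSq_eq_zero_iff {m n : Type*} [Fintype m] [Fintype n] (A : Matrix m n ℂ) :
    frobSq A = 0 ↔ A = 0 := by
  rw [frobSq, Finset.sum_eq_zero_iff_of_nonneg
    fun _ _ => Finset.sum_nonneg fun _ _ => sq_nonneg _]
  simp [Finset.sum_eq_zero_iff_of_nonneg, ← Matrix.ext_iff]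

/-- A matrix of full row rank can be cancelled on the right. -/
theorem Matrix.eq_zero_of_mul_eq_zero_of_rank_eq_card {K l m n : Type*} [Field K] [Fintype m]
    [Fintype n] {C : Matrix l m K} {B : Matrix m n K} (hB : B.rank = Fintype.card m)
    (h : C * B = 0) : C = 0 := by
  have hB_rows : LinearIndependent K B.row := by
    rw [linearIndependent_iff_card_eq_finrank_span, ← hB, Matrix.rank_eq_finrank_span_row]
    rfl
  have hB_inj := Matrix.vecMul_injective_iff.2 hB_rows
  ext i j
  have h_row : C i ᵥ* B = 0 ᵥ* B := by
    rw [Matrix.zero_vecMul, ← Matrix.mul_apply_eq_vecMul, h]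
    rfl
  exact congrFun (hB_inj h_row) j

/-- With an economy SVD `Ψ_X = U Σ Vᴴ` and `A = U B` with `B` of rank `r`, the KDMD
matrix `K̂ = Σ⁻¹ Vᴴ Ψ_Yᴴ U` is the unique minimizer of
`J'(K̂) = ‖(Vᴴ Ψ_Yᴴ − Σ K̂ Uᴴ) A‖_F²`, and `K̂ = Σ⁻¹ Vᴴ Ψ_Yᴴ Ψ_X V Σ⁻¹`. -/
theorem kdmd_solution
    {N M r N' : ℕ}
    (ΨX ΨY : Matrix (Fin N) (Fin M) ℂ)
    (U : Matrix (Fin N) (Fin r) ℂ) (V : Matrix (Fin M) (Fin r) ℂ)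
    (σ : Fin r → ℝ) (hσ : ∀ i, 0 < σ i)
    (hU : Uᴴ * U = 1) (hV : Vᴴ * V = 1)
    (hSVD : ΨX = U * Matrix.diagonal (fun i => (σ i : ℂ)) * Vᴴ)
    (B : Matrix (Fin r) (Fin N') ℂ) (hB : B.rank = r)
    (A : Matrix (Fin N) (Fin N') ℂ) (hA : A = U * B) :
    (∀ Khat : Matrix (Fin r) (Fin r) ℂ,
        (∀ K' : Matrix (Fin r) (Fin r) ℂ,
            frobSq ((Vᴴ * ΨYᴴ - Matrix.diagonal (fun i => (σ i : ℂ)) * Khat * Uᴴ) * A)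
              ≤ frobSq ((Vᴴ * ΨYᴴ - Matrix.diagonal (fun i => (σ i : ℂ)) * K' * Uᴴ) * A))
          ↔ Khat = (Matrix.diagonal (fun i => (σ i : ℂ)))⁻¹ * Vᴴ * ΨYᴴ * U)
    ∧ (Matrix.diagonal (fun i => (σ i : ℂ)))⁻¹ * Vᴴ * ΨYᴴ * U
        = (Matrix.diagonal (fun i => (σ i : ℂ)))⁻¹ * Vᴴ * ΨYᴴ * ΨX * V
            * (Matrix.diagonal (fun i => (σ i : ℂ)))⁻¹ := by
  have hS : IsUnit (Matrix.diagonal (fun i => (σ i : ℂ))).det := by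
    rw [Matrix.det_diagonal, isUnit_iff_ne_zero]
    exact Finset.prod_ne_zero_iff.2 fun i _ => Complex.ofReal_ne_zero.2 (hσ i).ne'
  generalize Matrix.diagonal (fun i => (σ i : ℂ)) = S at hS hSVD ⊢
  have h_res (K : Matrix (Fin r) (Fin r) ℂ) :
      (Vᴴ * ΨYᴴ - S * K * Uᴴ) * A = (Vᴴ * ΨYᴴ * U - S * K) * B := by
    rw [hA, ← Matrix.mul_assoc, Matrix.sub_mul, Matrix.mul_assoc (S * K), hU, Matrix.mul_one]
  have h_zero (K : Matrix (Fin r) (Fin r) ℂ) :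
      frobSq ((Vᴴ * ΨYᴴ - S * K * Uᴴ) * A) = 0 ↔ K = S⁻¹ * Vᴴ * ΨYᴴ * U := by
    rw [frobSq_eq_zero_iff, h_res]
    constructor
    · intro h
      have h_eq := sub_eq_zero.1
        (Matrix.eq_zero_of_mul_eq_zero_of_rank_eq_card (by simpa using hB) h)
      simp only [Matrix.mul_assoc] at h_eq ⊢
      rw [h_eq, Matrix.nonsing_inv_mul_cancel_left _ _ hS]
    · rintro rfl
      simp only [Matrix.mul_assoc]
      rw [Matrix.mul_nonsing_inv_cancel_left _ _ hS, sub_self, Matrix.zero_mul]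
  refine ⟨fun K => ⟨fun h => ?_, fun h K' => ?_⟩, ?_⟩
  · exact (h_zero K).1 <|
      le_antisymm ((h _).trans_eq ((h_zero _).2 rfl)) (frobSq_nonneg _)
  · rw [(h_zero K).2 h]
    exact frobSq_nonneg _
  · rw [hSVD]
    simp only [Matrix.mul_assoc]
    rw [← Matrix.mul_assoc Vᴴ V, hV, Matrix.one_mul, Matrix.mul_nonsing_inv _ hS, Matrix.mul_one]
end

section
/- Let Ψ_X, Ψ_Y ∈ ℂ^{N×M}, and let K ∈ ℂ^{N×N} satisfy the EDMD normal equations Ψ_X Ψ_Xᴴ K = Ψ_X Ψ_Yᴴ and have column space contained in the column space of Ψ_X. If w ∈ ℂ^N lies in the column space of Ψ_X and satisfies Ψ_Yᴴ w = μ Ψ_Xᴴ w for some μ ∈ ℂ, then K w = μ w. -/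
open Matrix

/-- If `K` satisfies the EDMD normal equations `Ψ_X Ψ_Xᴴ K = Ψ_X Ψ_Yᴴ` and has column
space contained in that of `Ψ_X`, and `w` lies in the column space of `Ψ_X` and satisfies
`Ψ_Yᴴ w = μ Ψ_Xᴴ w`, then `K w = μ w`. -/
theorem edmd_captures_eigenvector
    {N M : ℕ}
    (ΨX ΨY : Matrix (Fin N) (Fin M) ℂ)
    (K : Matrix (Fin N) (Fin N) ℂ)
    (hK : ΨX * ΨXᴴ * K = ΨX * ΨYᴴ)
    (hrange : LinearMap.range K.mulVecLin ≤ LinearMap.range ΨX.mulVecLin)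
    (w : Fin N → ℂ) (hw : w ∈ LinearMap.range ΨX.mulVecLin)
    (μ : ℂ) (heig : ΨYᴴ.mulVec w = μ • ΨXᴴ.mulVec w) :
    K.mulVec w = μ • w := by
  have hmem : K.mulVec w - μ • w ∈ LinearMap.range ΨX.mulVecLin :=
    Submodule.sub_mem _ (hrange ⟨w, rfl⟩) (Submodule.smul_mem _ μ hw)
  have hzero : (ΨX * ΨXᴴ).mulVec (K.mulVec w - μ • w) = 0 := by
    rw [mulVec_sub, mulVec_mulVec, hK, mulVec_smul, ← mulVec_mulVec, heig, mulVec_smul,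
      mulVec_mulVec, sub_self]
  open scoped ComplexOrder in
  rw [self_mul_conjTranspose_mulVec_eq_zero] at hzero
  obtain ⟨u, hu⟩ := hmem
  rw [mulVecLin_apply] at hu
  open scoped ComplexOrder in
  rw [← hu, mulVec_mulVec, conjTranspose_mul_self_mulVec_eq_zero, hu] at hzero
  exact sub_eq_zero.mp hzero
end

section
/- Let Ψ_X ∈ ℂ^{N×M} have economy SVD Ψ_X = U Σ Vᴴ (U ∈ ℂ^{N×r}, V ∈ ℂ^{M×r} with orthonormal columns, Σ ∈ ℝ^{r×r} diagonal with strictly positive entries), let Ψ_Y ∈ ℂ^{N×M}, and define the KDMD matrix K̂ = Σ⁻¹ Vᴴ Ψ_Yᴴ U. If ŵ ∈ ℂ^r and μ ∈ ℂ satisfy Ψ_Yᴴ (U ŵ) = μ Ψ_Xᴴ (U ŵ), then K̂ ŵ = μ ŵ. -/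
open Matrix

/-- With an economy SVD `Ψ_X = U Σ Vᴴ` and the KDMD matrix `K̂ = Σ⁻¹ Vᴴ Ψ_Yᴴ U`:
if `ŵ` and `μ` satisfy `Ψ_Yᴴ (U ŵ) = μ Ψ_Xᴴ (U ŵ)`, then `K̂ ŵ = μ ŵ`. -/
theorem kdmd_captures_eigenvector
    {N M r : ℕ}
    (ΨX ΨY : Matrix (Fin N) (Fin M) ℂ)
    (U : Matrix (Fin N) (Fin r) ℂ) (V : Matrix (Fin M) (Fin r) ℂ)
    (σ : Fin r → ℝ) (hσ : ∀ i, 0 < σ i)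
    (hU : Uᴴ * U = 1) (hV : Vᴴ * V = 1)
    (hSVD : ΨX = U * Matrix.diagonal (fun i => (σ i : ℂ)) * Vᴴ)
    (w : Fin r → ℂ) (μ : ℂ)
    (heig : ΨYᴴ.mulVec (U.mulVec w) = μ • ΨXᴴ.mulVec (U.mulVec w)) :
    ((Matrix.diagonal (fun i => (σ i : ℂ)))⁻¹ * Vᴴ * ΨYᴴ * U).mulVec w = μ • w := by
  have hdiag : IsUnit (Matrix.diagonal (fun i => (σ i : ℂ))).det := by
    simp [Matrix.det_diagonal, Finset.prod_ne_zero_iff, fun i => (hσ i).ne']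
  have hherm : (Matrix.diagonal (fun i => (σ i : ℂ)))ᴴ = Matrix.diagonal (fun i => (σ i : ℂ)) := by
    rw [Matrix.diagonal_conjTranspose]
    congr 1
    ext i
    simp
  have hXU : ΨXᴴ * U = V * Matrix.diagonal (fun i => (σ i : ℂ)) := by
    rw [hSVD, Matrix.conjTranspose_mul, Matrix.conjTranspose_mul, Matrix.conjTranspose_conjTranspose,
      hherm, Matrix.mul_assoc, Matrix.mul_assoc, hU, Matrix.mul_one]
  rw [Matrix.mulVec_mulVec w ΨXᴴ U, hXU] at heig
  rw [← Matrix.mulVec_mulVec, ← Matrix.mulVec_mulVec, heig, Matrix.mulVec_smul,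
    Matrix.mulVec_mulVec, Matrix.mul_assoc, ← Matrix.mul_assoc Vᴴ, hV, Matrix.one_mul,
    Matrix.nonsing_inv_mul _ hdiag, Matrix.one_mulVec]
end

section
/- Let X ∈ ℂ^{n×M}, let V ∈ ℂ^{M×r} have orthonormal columns (VᴴV = I_r), let Σ ∈ ℝ^{r×r} be diagonal with strictly positive diagonal entries, and let Ŵ_R, Ŵ_L ∈ ℂ^{r×r} be bi-orthonormal, i.e. Ŵ_Lᴴ Ŵ_R = I_r. Define the eigenfunction value matrix Φ_X = Ŵ_Rᵀ Σ Vᵀ ∈ ℂ^{r×M}. Then the matrix Ξ = X · conj(V) Σ⁻¹ conj(Ŵ_L) minimizes ‖X − Ξ Φ_X‖_F² over all Ξ ∈ ℂ^{n×r}. -/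
open Matrix

theorem frobSq_eq_re_trace {m n : Type*} [Fintype m] [Fintype n] (A : Matrix m n ℂ) :
    frobSq A = (A * Aᴴ).trace.re := by
  simp [frobSq, Matrix.trace, Matrix.mul_apply, Complex.mul_conj, Complex.normSq_eq_norm_sq,
    -Complex.ofReal_pow]

/-- Pythagoras for the Frobenius norm. -/
theorem frobSq_add_of_mul_conjTranspose_eq_zero {m n : Type*} [Fintype m] [Fintype n]
    {A B : Matrix m n ℂ} (h : A * Bᴴ = 0) : frobSq (A + B) = frobSq A + frobSq B := by
  have h' : B * Aᴴ = 0 := by simpa using congrArg conjTranspose h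
  simp [frobSq_eq_re_trace, Matrix.add_mul, Matrix.mul_add, h, h']

/-- The normal equations are sufficient for a least-squares minimizer. -/
theorem frobSq_sub_mul_le_of_normal_equations {m n k : Type*} [Fintype m] [Fintype n] [Fintype k]
    {X : Matrix m n ℂ} {Φ : Matrix k n ℂ} {Ξ : Matrix m k ℂ} (h : (X - Ξ * Φ) * Φᴴ = 0)
    (Ξ' : Matrix m k ℂ) : frobSq (X - Ξ * Φ) ≤ frobSq (X - Ξ' * Φ) := by
  have hsplit : X - Ξ' * Φ = (X - Ξ * Φ) + (Ξ - Ξ') * Φ := by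
    rw [Matrix.sub_mul]
    abel
  have horth : (X - Ξ * Φ) * ((Ξ - Ξ') * Φ)ᴴ = 0 := by
    rw [conjTranspose_mul, ← Matrix.mul_assoc, h, Matrix.zero_mul]
  rw [hsplit, frobSq_add_of_mul_conjTranspose_eq_zero horth]
  exact le_add_of_nonneg_right (frobSq_nonneg _)

/-- The Koopman mode matrix `Ξ = X · conj(V) Σ⁻¹ conj(Ŵ_L)` minimizes
`‖X − Ξ Φ_X‖_F²` where `Φ_X = Ŵ_Rᵀ Σ Vᵀ`, for bi-orthonormal `Ŵ_Lᴴ Ŵ_R = I`. -/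
theorem koopman_modes_least_squares
    {n M r : ℕ}
    (X : Matrix (Fin n) (Fin M) ℂ)
    (V : Matrix (Fin M) (Fin r) ℂ) (hV : Vᴴ * V = 1)
    (σ : Fin r → ℝ) (hσ : ∀ i, 0 < σ i)
    (WR WL : Matrix (Fin r) (Fin r) ℂ)
    (hbi : WLᴴ * WR = 1) :
    ∀ Ξ' : Matrix (Fin n) (Fin r) ℂ,
      frobSq (X -
          (X * V.map (starRingEnd ℂ) * (Matrix.diagonal (fun i => (σ i : ℂ)))⁻¹
              * WL.map (starRingEnd ℂ))
            * (WRᵀ * Matrix.diagonal (fun i => (σ i : ℂ)) * Vᵀ))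
        ≤ frobSq (X - Ξ' * (WRᵀ * Matrix.diagonal (fun i => (σ i : ℂ)) * Vᵀ)) := by
  intro Ξ'
  apply frobSq_sub_mul_le_of_normal_equations
  set S : Matrix (Fin r) (Fin r) ℂ := Matrix.diagonal (fun i => (σ i : ℂ))
  have hS : S⁻¹ * S = 1 := by
    apply Matrix.nonsing_inv_mul
    simp [S, Matrix.det_diagonal, isUnit_iff_ne_zero, Finset.prod_ne_zero_iff, (hσ _).ne']
  have hW : WL.map (starRingEnd ℂ) * WRᵀ = 1 := by
    have h := congrArg transpose (mul_eq_one_comm.mp hbi)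
    rwa [transpose_mul, transpose_one] at h
  have hVc : Vᵀ * V.map (starRingEnd ℂ) = 1 := by
    have h := congrArg transpose hV
    rwa [transpose_mul, transpose_one] at h
  have hrec : X * V.map (starRingEnd ℂ) * S⁻¹ * WL.map (starRingEnd ℂ) * (WRᵀ * S * Vᵀ)
      = X * V.map (starRingEnd ℂ) * Vᵀ := by
    calc _ = X * V.map (starRingEnd ℂ) * (S⁻¹ * (WL.map (starRingEnd ℂ) * WRᵀ) * S) * Vᵀ := by
          simp only [Matrix.mul_assoc]
      _ = _ := by rw [hW, Matrix.mul_one, hS, Matrix.mul_one]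
  have hVt : Vᵀᴴ = V.map (starRingEnd ℂ) := rfl
  rw [hrec, conjTranspose_mul, hVt, ← Matrix.mul_assoc, Matrix.sub_mul,
    Matrix.mul_assoc (X * V.map (starRingEnd ℂ)), hVc, Matrix.mul_one, sub_self, Matrix.zero_mul]
end

section
/- Let A ∈ ℂ^{r×p}, B ∈ ℂ^{r×q}, and let H = Aᴴ B have economy SVD H = U_H Σ_H V_Hᴴ, where U_H ∈ ℂ^{p×d} and V_H ∈ ℂ^{q×d} have orthonormal columns and Σ_H ∈ ℝ^{d×d} is diagonal with strictly positive diagonal entries (d = rank H). Define the balancing modes T = B V_H Σ_H^{−1/2} and adjoint modes S = A U_H Σ_H^{−1/2}. Then Sᴴ T = I_d, and T Sᴴ is idempotent: (T Sᴴ)² = T Sᴴ (i.e. T Sᴴ is a projection onto the range of T). -/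
open Matrix

/-- Given `H = Aᴴ B` with economy SVD `H = U_H Σ_H V_Hᴴ` (rank `d`), the balancing
modes `T = B V_H Σ_H^{−1/2}` and adjoint modes `S = A U_H Σ_H^{−1/2}` satisfy
`Sᴴ T = I_d`, and `T Sᴴ` is idempotent. -/
theorem balancing_modes_biorthogonal
    {r p q d : ℕ}
    (A : Matrix (Fin r) (Fin p) ℂ) (B : Matrix (Fin r) (Fin q) ℂ)
    (UH : Matrix (Fin p) (Fin d) ℂ) (VH : Matrix (Fin q) (Fin d) ℂ)
    (σ : Fin d → ℝ) (hσ : ∀ i, 0 < σ i)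
    (hUH : UHᴴ * UH = 1) (hVH : VHᴴ * VH = 1)
    (hSVD : Aᴴ * B = UH * Matrix.diagonal (fun i => (σ i : ℂ)) * VHᴴ)
    (hrank : (Aᴴ * B).rank = d) :
    (A * UH * Matrix.diagonal (fun i => ((Real.sqrt (σ i))⁻¹ : ℂ)))ᴴ
        * (B * VH * Matrix.diagonal (fun i => ((Real.sqrt (σ i))⁻¹ : ℂ))) = 1
    ∧ ((B * VH * Matrix.diagonal (fun i => ((Real.sqrt (σ i))⁻¹ : ℂ)))
          * (A * UH * Matrix.diagonal (fun i => ((Real.sqrt (σ i))⁻¹ : ℂ)))ᴴ)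
        * ((B * VH * Matrix.diagonal (fun i => ((Real.sqrt (σ i))⁻¹ : ℂ)))
          * (A * UH * Matrix.diagonal (fun i => ((Real.sqrt (σ i))⁻¹ : ℂ)))ᴴ)
      = (B * VH * Matrix.diagonal (fun i => ((Real.sqrt (σ i))⁻¹ : ℂ)))
          * (A * UH * Matrix.diagonal (fun i => ((Real.sqrt (σ i))⁻¹ : ℂ)))ᴴ := by
  have hcore : UHᴴ * (Aᴴ * B) * VH = Matrix.diagonal (fun i => (σ i : ℂ)) := by
    rw [hSVD, Matrix.mul_assoc, Matrix.mul_assoc _ VHᴴ, hVH, Matrix.mul_one,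
      ← Matrix.mul_assoc, hUH, Matrix.one_mul]
  have hscale : (Matrix.diagonal (fun i => ((Real.sqrt (σ i))⁻¹ : ℂ)))ᴴ
      * Matrix.diagonal (fun i => (σ i : ℂ))
      * Matrix.diagonal (fun i => ((Real.sqrt (σ i))⁻¹ : ℂ)) = 1 := by
    rw [Matrix.diagonal_conjTranspose, Matrix.diagonal_mul_diagonal,
      Matrix.diagonal_mul_diagonal, ← Matrix.diagonal_one]
    congr 1
    funext i
    have hne : (Real.sqrt (σ i) : ℂ) ≠ 0 :=
      Complex.ofReal_ne_zero.mpr (Real.sqrt_pos.mpr (hσ i)).ne'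
    have hsq : (σ i : ℂ) = Real.sqrt (σ i) * Real.sqrt (σ i) := by
      rw [← Complex.ofReal_mul, Real.mul_self_sqrt (hσ i).le]
    have hstar : star ((Real.sqrt (σ i) : ℂ)⁻¹) = (Real.sqrt (σ i) : ℂ)⁻¹ := by
      rw [star_inv₀, Complex.star_def, Complex.conj_ofReal]
    rw [Pi.star_apply, hstar, hsq]
    field_simp
  have hbi : (A * UH * Matrix.diagonal (fun i => ((Real.sqrt (σ i))⁻¹ : ℂ)))ᴴ
      * (B * VH * Matrix.diagonal (fun i => ((Real.sqrt (σ i))⁻¹ : ℂ))) = 1 := by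
    rw [← hscale, ← hcore]
    simp only [Matrix.conjTranspose_mul, Matrix.mul_assoc]
  refine ⟨hbi, ?_⟩
  rw [Matrix.mul_assoc, ← Matrix.mul_assoc (_ᴴ), hbi, Matrix.one_mul]
end

section
/- Let A ∈ ℂ^{r×p}, B ∈ ℂ^{r×q}, and let H = Aᴴ B have economy SVD H = U_H Σ_H V_Hᴴ, where U_H ∈ ℂ^{p×d} and V_H ∈ ℂ^{q×d} have orthonormal columns and Σ_H ∈ ℝ^{d×d} is diagonal with strictly positive diagonal entries (d = rank H). Define W_o = A Aᴴ, W_c = B Bᴴ, T = B V_H Σ_H^{−1/2}, and S = A U_H Σ_H^{−1/2}. Then the transformation simultaneously diagonalizes the two Gramians: Tᴴ W_o T = Sᴴ W_c S = Σ_H. -/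
open Matrix

/-- If `Aᴴ B = U Σ Vᴴ` is an economy SVD, then `T = B V Σ^{−1/2}` satisfies `Tᴴ (A Aᴴ) T = Σ`. -/
theorem conjTranspose_mul_gramian_mul_eq_diagonal
    {l m n k : Type*} [Fintype l] [Fintype m] [Fintype n] [Fintype k] [DecidableEq k]
    (A : Matrix l m ℂ) (B : Matrix l n ℂ) (U : Matrix m k ℂ) (V : Matrix n k ℂ)
    (σ : k → ℝ) (hσ : ∀ i, 0 < σ i) (hU : Uᴴ * U = 1) (hV : Vᴴ * V = 1)
    (hSVD : Aᴴ * B = U * diagonal (fun i => (σ i : ℂ)) * Vᴴ) :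
    (B * V * diagonal (fun i => ((Real.sqrt (σ i))⁻¹ : ℂ)))ᴴ * (A * Aᴴ)
        * (B * V * diagonal (fun i => ((Real.sqrt (σ i))⁻¹ : ℂ)))
      = diagonal (fun i => (σ i : ℂ)) := by
  have hdiag : diagonal (fun i => (σ i : ℂ)) * diagonal (fun i => ((Real.sqrt (σ i))⁻¹ : ℂ))
      = diagonal (fun i => (Real.sqrt (σ i) : ℂ)) := by
    rw [diagonal_mul_diagonal]
    congr 1
    funext i
    rw [← Complex.ofReal_inv, ← Complex.ofReal_mul, ← div_eq_mul_inv, Real.div_sqrt]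
  have hAT : Aᴴ * (B * V * diagonal (fun i => ((Real.sqrt (σ i))⁻¹ : ℂ)))
      = U * diagonal (fun i => (Real.sqrt (σ i) : ℂ)) := by
    rw [← Matrix.mul_assoc, ← Matrix.mul_assoc, hSVD, Matrix.mul_assoc _ Vᴴ V, hV,
      Matrix.mul_one, Matrix.mul_assoc, hdiag]
  generalize B * V * diagonal (fun i => ((Real.sqrt (σ i))⁻¹ : ℂ)) = T at hAT ⊢
  calc Tᴴ * (A * Aᴴ) * T = (Aᴴ * T)ᴴ * (Aᴴ * T) := by
        simp only [conjTranspose_mul, conjTranspose_conjTranspose, Matrix.mul_assoc]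
    _ = (diagonal (fun i => (Real.sqrt (σ i) : ℂ)))ᴴ * (Uᴴ * U)
          * diagonal (fun i => (Real.sqrt (σ i) : ℂ)) := by
        simp only [hAT, conjTranspose_mul, Matrix.mul_assoc]
    _ = diagonal (fun i => (σ i : ℂ)) := by
        rw [hU, Matrix.mul_one, diagonal_conjTranspose, diagonal_mul_diagonal]
        congr 1
        funext i
        rw [Pi.star_apply, Complex.star_def, Complex.conj_ofReal, ← Complex.ofReal_mul,
          Real.mul_self_sqrt (hσ i).le]

/-- Given `H = Aᴴ B` with economy SVD `H = U_H Σ_H V_Hᴴ` (rank `d`), the balancing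
transformation simultaneously diagonalizes the Gramians `W_o = A Aᴴ` and `W_c = B Bᴴ`:
`Tᴴ W_o T = Sᴴ W_c S = Σ_H`, where `T = B V_H Σ_H^{−1/2}` and `S = A U_H Σ_H^{−1/2}`. -/
theorem balancing_diagonalizes_gramians
    {r p q d : ℕ}
    (A : Matrix (Fin r) (Fin p) ℂ) (B : Matrix (Fin r) (Fin q) ℂ)
    (UH : Matrix (Fin p) (Fin d) ℂ) (VH : Matrix (Fin q) (Fin d) ℂ)
    (σ : Fin d → ℝ) (hσ : ∀ i, 0 < σ i)
    (hUH : UHᴴ * UH = 1) (hVH : VHᴴ * VH = 1)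
    (hSVD : Aᴴ * B = UH * Matrix.diagonal (fun i => (σ i : ℂ)) * VHᴴ)
    (hrank : (Aᴴ * B).rank = d) :
    (B * VH * Matrix.diagonal (fun i => ((Real.sqrt (σ i))⁻¹ : ℂ)))ᴴ
        * (A * Aᴴ)
        * (B * VH * Matrix.diagonal (fun i => ((Real.sqrt (σ i))⁻¹ : ℂ)))
      = Matrix.diagonal (fun i => (σ i : ℂ))
    ∧ (A * UH * Matrix.diagonal (fun i => ((Real.sqrt (σ i))⁻¹ : ℂ)))ᴴ
        * (B * Bᴴ)
        * (A * UH * Matrix.diagonal (fun i => ((Real.sqrt (σ i))⁻¹ : ℂ)))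
      = Matrix.diagonal (fun i => (σ i : ℂ)) := by
  refine ⟨conjTranspose_mul_gramian_mul_eq_diagonal A B UH VH σ hσ hUH hVH hSVD,
    conjTranspose_mul_gramian_mul_eq_diagonal B A VH UH σ hσ hVH hUH ?_⟩
  have hstar : star (fun i => (σ i : ℂ)) = fun i => (σ i : ℂ) :=
    funext fun i => Complex.conj_ofReal (σ i)
  have h := congrArg conjTranspose hSVD
  simpa only [conjTranspose_mul, conjTranspose_conjTranspose, diagonal_conjTranspose, hstar,
    Matrix.mul_assoc] using h
end

section
/- Let B be a set, f : B → B, and U ⊆ B with f(U) ⊆ U (U is positively invariant). Let μ ∈ ℂ with μ ≠ 0 and let h : B → ℂ satisfy h(f(x)) = μ h(x) for all x ∈ U. Assume that for every x ∈ B there exists τ ∈ ℕ with f^τ(x) ∈ U, and let τ(x) denote the smallest such τ. Define φ : B → ℂ by φ(x) = μ^{−τ(x)} · h(f^{τ(x)}(x)). Then φ agrees with h on U, and φ is a Koopman eigenfunction with eigenvalue μ on all of B: φ(f(x)) = μ φ(x) for every x ∈ B. -/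
open Function

/-- Extension of a local Koopman eigenfunction to the whole basin of attraction:
if `h(f(x)) = μ h(x)` on a positively invariant set `U ⊆ B`, every point of `B`
reaches `U` in finite time with first-hitting time `τ`, and
`φ(x) = μ^{−τ(x)} h(f^{τ(x)}(x))` on `B`, then `φ` agrees with `h` on `U` and is a
Koopman eigenfunction with eigenvalue `μ` on all of `B`. -/
theorem koopman_eigenfunction_basin_extension
    {α : Type*} (f : α → α) (B U : Set α)
    (hUB : U ⊆ B)
    (hfB : ∀ x ∈ B, f x ∈ B)
    (hfU : ∀ x ∈ U, f x ∈ U)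
    (μ : ℂ) (hμ : μ ≠ 0)
    (h : α → ℂ)
    (heig : ∀ x ∈ U, h (f x) = μ * h x)
    (τ : α → ℕ)
    (hτ : ∀ x ∈ B, f^[τ x] x ∈ U ∧ ∀ s < τ x, f^[s] x ∉ U)
    (φ : α → ℂ)
    (hφ : ∀ x ∈ B, φ x = μ ^ (-(τ x : ℤ)) * h (f^[τ x] x)) :
    (∀ x ∈ U, φ x = h x) ∧ ∀ x ∈ B, φ (f x) = μ * φ x := by
  have hagree : ∀ x ∈ U, φ x = h x := by
    intro x hx
    have h0 : τ x = 0 := by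
      by_contra hne
      exact (hτ x (hUB hx)).2 0 (Nat.pos_of_ne_zero hne) hx
    simp [hφ x (hUB hx), h0]
  refine ⟨hagree, fun x hx => ?_⟩
  by_cases hxU : x ∈ U
  · rw [hagree _ (hfU x hxU), hagree x hxU, heig x hxU]
  obtain ⟨hmem, hmin⟩ := hτ x hx
  obtain ⟨hmem', hmin'⟩ := hτ (f x) (hfB x hx)
  obtain ⟨n, hn⟩ : ∃ n, τ x = n + 1 := by
    refine Nat.exists_eq_succ_of_ne_zero fun h0 => hxU ?_
    simpa [h0] using hmem
  have hstep : τ (f x) = n := by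
    rw [hn, iterate_succ_apply] at hmem
    refine le_antisymm (not_lt.1 fun hlt => hmin' n hlt hmem) (not_lt.1 fun hlt => ?_)
    refine hmin (τ (f x) + 1) (by omega) ?_
    rwa [iterate_succ_apply]
  rw [hφ _ (hfB x hx), hφ x hx, hstep, hn, iterate_succ_apply, ← mul_assoc,
    ← zpow_one_add₀ hμ]
  congr 2
  push_cast
  ring
end
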